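/- Let (n_1, …, n_k) ∈ ℕ^k be syllable sizes, with SI/NSI syllable labels given by the combinatorial model applied to the word (n_1, …, n_k) (the labels depend only on the sizes |a_i|). Suppose the total number of SI crossings is odd and the total number of NSI crossings is even. Then, in the resolution game on (n_1, …, n_k): (i) the first player can force the resulting word w = (s_1, …, s_k) to satisfy w ≈ (0); and (ii) if moreover the last maximal run of NSI syllables contains at least one crossing, the first player can force w to satisfy w ≈ (2), w ≈ (−2), or w ≈ (2, c) or w ≈ (−2, c) for some integer c. -/

import Mathlib

/-- The three connectivity states of a partially built rational tangle:
`H = {NW–NE, SW–SE}`, `V = {NW–SW, NE–SE}`, `X = {NW–SE, NE–SW}`. -/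
inductive TState : Type
  | H
  | V
  | X
  deriving DecidableEq

/-- Effect of a bottom crossing (a twist of SW and SE) on the connectivity state. -/
def bstep : TState → TState
  | .H => .H
  | .V => .X
  | .X => .V

/-- Effect of a right crossing (a twist of NE and SE) on the connectivity state. -/
def rstep : TState → TState
  | .V => .V
  | .H => .X
  | .X => .H

/-- `step true` is a bottom crossing, `step false` is a right crossing. -/
def step : Bool → TState → TState
  | true => bstep
  | false => rstep

/-- The twist direction of the (0-based) `i`-th syllable: bottom iff `i` is even
(1-based odd syllables are bottom twists). -/
def sylDir (i : ℕ) : Bool := decide (i % 2 = 0)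

/-- The state in which a crossing of the (0-based) `i`-th syllable is a self-intersection:
`H` for bottom syllables, `V` for right syllables. -/
def siState (i : ℕ) : TState := if i % 2 = 0 then TState.H else TState.V

/-- Process a list of syllables starting from state `s`; the Boolean `b` records
whether the next syllable is a bottom syllable. Each syllable `a` applies
`|a|` crossings of the appropriate direction. -/
def runWord : List ℤ → Bool → TState → TState
  | [], _, s => s
  | a :: t, b, s => runWord t (!b) ((step b)^[a.natAbs] s)

/-- The connectivity state at the start of the (0-based) `i`-th syllable of the word `w`
(a rational tangle word starts in state `V`). -/
def stateAt (w : List ℤ) (i : ℕ) : TState := runWord (w.take i) true TState.V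

/-- The (0-based) `i`-th syllable of `w` is an SI syllable. -/
def IsSISyl (w : List ℤ) (i : ℕ) : Prop := stateAt w i = siState i

instance (w : List ℤ) (i : ℕ) : Decidable (IsSISyl w i) :=
  inferInstanceAs (Decidable (_ = _))

/-- `IsNSIRun w l r` : the syllables with (0-based) indices in `[l, r)` form a maximal run
of NSI syllables of `w`. -/
def IsNSIRun (w : List ℤ) (l r : ℕ) : Prop :=
  l < r ∧ r ≤ w.length ∧ (∀ j, l ≤ j → j < r → ¬ IsSISyl w j) ∧
    (l = 0 ∨ IsSISyl w (l - 1)) ∧ (r = w.length ∨ IsSISyl w r)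

/-- The last maximal run of NSI syllables: a maximal run such that every later syllable
is an SI syllable. -/
def IsLastNSIRun (w : List ℤ) (l r : ℕ) : Prop :=
  IsNSIRun w l r ∧ ∀ j, r ≤ j → j < w.length → IsSISyl w j

/-- Run shape (a): a single even syllable. -/
def RunA (w : List ℤ) (l r : ℕ) : Prop := r = l + 1 ∧ Even (w.getD l 0)

/-- Run shape (b): two consecutive odd syllables. -/
def RunB (w : List ℤ) (l r : ℕ) : Prop :=
  r = l + 2 ∧ Odd (w.getD l 0) ∧ Odd (w.getD (l + 1) 0)

/-- Run shape (c): an odd syllable, then a nonempty string of even syllables,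
then a final odd syllable. -/
def RunC (w : List ℤ) (l r : ℕ) : Prop :=
  l + 3 ≤ r ∧ Odd (w.getD l 0) ∧ Odd (w.getD (r - 1) 0) ∧
    ∀ j, l < j → j < r - 1 → Even (w.getD j 0)

/-- Run shape (a'): a single odd syllable. -/
def RunA' (w : List ℤ) (l r : ℕ) : Prop := r = l + 1 ∧ Odd (w.getD l 0)

/-- Run shape (b'): an odd syllable followed by a nonempty string of even syllables. -/
def RunB' (w : List ℤ) (l r : ℕ) : Prop :=
  l + 2 ≤ r ∧ Odd (w.getD l 0) ∧ ∀ j, l < j → j < r → Even (w.getD j 0)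

/-- The number of NSI crossings of the word `w`: the sum of `|a_i|` over the NSI
syllables `a_i` of `w`. -/
def nsiCrossings (w : List ℤ) : ℕ :=
  ∑ i ∈ Finset.range w.length, if IsSISyl w i then 0 else (w.getD i 0).natAbs

/-- The number of SI crossings of the word `w`: the sum of `|a_i|` over the SI
syllables `a_i` of `w`. -/
def siCrossings (w : List ℤ) : ℕ :=
  ∑ i ∈ Finset.range w.length, if IsSISyl w i then (w.getD i 0).natAbs else 0

/-- Tangle-word reduction: the smallest equivalence relation on nonempty finite
sequences of integers closed under the moves (0)–(5). -/
inductive TEq : List ℤ → List ℤ → Prop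
  /-- (0) `(a_1,…,a_k,0) ≈ (a_1,…,a_k)` -/
  | move0 (l : List ℤ) (h : l ≠ []) : TEq (l ++ [0]) l
  /-- (1) `(a_1,…,a_i,0,a_{i+1},…,a_n) ≈ (a_1,…,a_{i-1},a_i+a_{i+1},a_{i+2},…,a_n)` -/
  | move1 (l r : List ℤ) (a b : ℤ) : TEq (l ++ a :: 0 :: b :: r) (l ++ (a + b) :: r)
  /-- (2) `(a_1,…,a_i,0,0,a_{i+1},…,a_n) ≈ (a_1,…,a_i,a_{i+1},…,a_n)` -/
  | move2 (l r : List ℤ) (h : l ++ r ≠ []) : TEq (l ++ 0 :: 0 :: r) (l ++ r)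
  /-- (3) `(0,a+1,a_2,…,a_n) ≈ (0,a,a_2,…,a_n)` -/
  | move3 (a : ℤ) (r : List ℤ) : TEq (0 :: (a + 1) :: r) (0 :: a :: r)
  /-- (4) `(1,a,a_2,…,a_n) ≈ (a+1,a_2,…,a_n)` -/
  | move4 (a : ℤ) (r : List ℤ) : TEq (1 :: a :: r) ((a + 1) :: r)
  /-- (5) `(-1,a,a_2,…,a_n) ≈ (a-1,a_2,…,a_n)` -/
  | move5 (a : ℤ) (r : List ℤ) : TEq ((-1) :: a :: r) ((a - 1) :: r)
  | refl (l : List ℤ) : TEq l l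
  | symm {l₁ l₂ : List ℤ} : TEq l₁ l₂ → TEq l₂ l₁
  | trans {l₁ l₂ l₃ : List ℤ} : TEq l₁ l₂ → TEq l₂ l₃ → TEq l₁ l₃

section SignGame

variable {C : Type*} [Fintype C]

/-- A play of the sign-assignment game is a list of moves, each assigning a sign to a
crossing; it is legal if no crossing is chosen twice and every sign is `+1` or `-1`. -/
def LegalPlay (p : List (C × ℤ)) : Prop :=
  (p.map Prod.fst).Nodup ∧ ∀ m ∈ p, m.2 = 1 ∨ m.2 = -1

/-- The play `p` follows the strategy `σ` of the player who moves at all positions whose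
number of prior moves is congruent to `parity` mod 2 (`parity = 0`: first player;
`parity = 1`: second player). -/
def Follows (parity : ℕ) (σ : List (C × ℤ) → C × ℤ) (p : List (C × ℤ)) : Prop :=
  ∀ (i : ℕ) (hi : i < p.length), i % 2 = parity → p.get ⟨i, hi⟩ = σ (p.take i)

/-- The strategy `σ` always produces a legal move (an unchosen crossing with sign `±1`)
at the positions where its player is to move. -/
def LegalStrat (parity : ℕ) (σ : List (C × ℤ) → C × ℤ) : Prop :=
  ∀ p : List (C × ℤ), LegalPlay p → p.length % 2 = parity → p.length < Fintype.card C →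
    (σ p).1 ∉ p.map Prod.fst ∧ ((σ p).2 = 1 ∨ (σ p).2 = -1)

/-- The player moving at positions of parity `parity` can force the predicate `P` on
complete plays: they have a legal strategy such that every complete legal play following
it satisfies `P`. -/
def CanForce (parity : ℕ) (P : List (C × ℤ) → Prop) : Prop :=
  ∃ σ : List (C × ℤ) → C × ℤ, LegalStrat parity σ ∧
    ∀ p : List (C × ℤ), LegalPlay p → p.length = Fintype.card C → Follows parity σ p → P p

end SignGame

/-- The crossings of the resolution game on syllable sizes `n = (n_1, …, n_k)`:
pairs `(i, j)` with `i` a syllable index and `j < n_i`. -/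
abbrev Cr (n : List ℕ) : Type := Σ i : Fin n.length, Fin (n.get i)

/-- The resulting word `(s_1, …, s_k)` of a complete play of the resolution game:
`s_i` is the sum of the signs assigned to the crossings of the `i`-th syllable. -/
def result (n : List ℕ) (p : List (Cr n × ℤ)) : List ℤ :=
  (List.finRange n.length).map fun i =>
    ((p.filter fun m => decide (m.1.1 = i)).map Prod.snd).sum

/-- The tangle word associated to the syllable sizes `(n_1, …, n_k)`
(SI/NSI labels depend only on the sizes `|a_i|`). -/
def natWord (n : List ℕ) : List ℤ := n.map fun x => (x : ℤ)

section PairingStrategy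

variable {C : Type*} [Fintype C]

/-- Pairing strategies: if every crossing other than `x₀` has exactly one partner, the first
player opens with `x₀` and then always answers on the partner of the crossing just played, with
the sign prescribed by `ε`. -/
theorem canForce_of_pairing (x₀ : C) (M : C → C → Prop) (ε : C → C → ℤ)
    (P : List (C × ℤ) → Prop)
    (hM_symm : ∀ c d, M c d → M d c) (hM_irrefl : ∀ c, ¬ M c c)
    (hM_unique : ∀ c d d', M c d → M c d' → d = d')
    (hM_exists : ∀ c, c ≠ x₀ → ∃ d, M c d) (hM_base : ∀ d, ¬ M x₀ d)
    (hε : ∀ c d, ε c d = 1 ∨ ε c d = -1) (hε_symm : ∀ c d, ε c d = ε d c)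
    (hP : ∀ (L : List C) (s : C → ℤ), L.Nodup → (∀ c, c ∈ L) → (∀ c, s c = 1 ∨ s c = -1) →
      (∀ c d, M c d → s d = ε c d * s c) → P (L.map fun c => (c, s c))) :
    CanForce 0 P := by
  classical
  let σ : List (C × ℤ) → C × ℤ := fun p =>
    match p.getLast? with
    | none => (x₀, 1)
    | some m =>
      if h : ∃ y, M m.1 y ∧ y ∉ p.map Prod.fst then (h.choose, ε m.1 h.choose * m.2)
      else if h : ∃ y, y ∉ p.map Prod.fst then (h.choose, 1) else (x₀, 1)
  refine ⟨σ, ?_, ?_⟩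
  · intro p hp _ hlen
    rcases List.eq_nil_or_concat p with rfl | ⟨q, m, rfl⟩
    · simp [σ]
    · have hunplayed : ∃ y, y ∉ (q.concat m).map Prod.fst := by
        by_contra! hall
        have hcard : Fintype.card C ≤ ((q.concat m).map Prod.fst).length := by
          rw [← Finset.card_univ, ← Finset.eq_univ_of_forall (s := _) fun c =>
            List.mem_toFinset.2 (hall c)]
          exact List.toFinset_card_le _
        rw [List.length_map] at hcard
        omega
      have hm : m.2 = 1 ∨ m.2 = -1 := hp.2 m (by simp)
      have hlast : (q.concat m).getLast? = some m := by simp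
      simp only [σ, hlast]
      split_ifs with h
      · refine ⟨h.choose_spec.2, ?_⟩
        change ε m.1 h.choose * m.2 = 1 ∨ ε m.1 h.choose * m.2 = -1
        rcases hm with h1 | h1 <;> rcases hε m.1 h.choose with h2 | h2 <;> rw [h1, h2] <;> simp
      · exact ⟨hunplayed.choose_spec, Or.inl rfl⟩
  · intro p hp hlen hfol
    have hall : ∀ c, c ∈ p.map Prod.fst := by
      have hu : (p.map Prod.fst).toFinset = Finset.univ := by
        rw [← Finset.card_eq_iff_eq_univ, List.toFinset_card_of_nodup hp.1, List.length_map, hlen]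
      intro c
      rw [← List.mem_toFinset, hu]
      exact Finset.mem_univ c
    have hpos : 0 < p.length := by
      rw [hlen]
      exact Fintype.card_pos_iff.2 ⟨x₀⟩
    have key : ∀ m, 2 * m + 1 ≤ p.length →
        (x₀, 1) ∈ p.take (2 * m + 1) ∧ ∀ c s, (c, s) ∈ p.take (2 * m + 1) → ∀ d, M c d →
          (d, ε c d * s) ∈ p.take (2 * m + 1) := by
      intro m
      induction m with
      | zero =>
        intro _
        have h0 : p[0] = (x₀, 1) := by
          have := hfol 0 hpos rfl
          simpa [σ] using this
        have ht : p.take (2 * 0 + 1) = [(x₀, 1)] := by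
          rw [Nat.mul_zero, List.take_add_one, List.getElem?_eq_getElem hpos, h0]
          simp
        rw [ht]
        refine ⟨by simp, fun c s hc d hd => ?_⟩
        rw [List.mem_singleton, Prod.mk.injEq] at hc
        exact absurd (hc.1 ▸ hd) (hM_base d)
      | succ m ih =>
        intro hm
        obtain ⟨hx, hcl⟩ := ih (by omega)
        have hlt1 : 2 * m + 1 < p.length := by omega
        have hlt2 : 2 * m + 1 + 1 < p.length := by omega
        set q := p.take (2 * m + 1) with hq
        have ht1 : p.take (2 * m + 1 + 1) = q ++ [p[2 * m + 1]] := by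
          rw [List.take_add_one, List.getElem?_eq_getElem hlt1]
          rfl
        have ht2 : p.take (2 * m + 1 + 1 + 1) = q ++ [p[2 * m + 1]] ++ [p[2 * m + 1 + 1]] := by
          rw [List.take_add_one, List.getElem?_eq_getElem hlt2, ht1]
          rfl
        have hnd : ((q ++ [p[2 * m + 1]] ++ [p[2 * m + 1 + 1]]).map Prod.fst).Nodup := by
          rw [← ht2, List.map_take]
          exact hp.1.sublist (List.take_sublist _ _)
        have hb := hfol (2 * m + 1 + 1) hlt2 (by omega)
        rw [List.get_eq_getElem, ht1] at hb
        change p.take (2 * m + 1 + 1 + 1) = _ at ht2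
        rw [show 2 * (m + 1) + 1 = 2 * m + 1 + 1 + 1 by ring, ht2]
        generalize p[2 * m + 1] = a at *
        generalize p[2 * m + 1 + 1] = b at *
        have ha : a.1 ∉ q.map Prod.fst := by
          simp only [List.map_append, List.nodup_append] at hnd
          intro h
          exact hnd.1.2.2 _ h a.1 (by simp) rfl
        have hax : a.1 ≠ x₀ := by
          rintro h
          exact ha (h ▸ List.mem_map_of_mem hx)
        obtain ⟨y, hy⟩ := hM_exists a.1 hax
        have hyq : y ∉ (q ++ [a]).map Prod.fst := by
          simp only [List.map_append, List.map_cons, List.map_nil, List.mem_append,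
            List.mem_singleton, not_or]
          refine ⟨fun h => ?_, fun h => hM_irrefl _ (h ▸ hy)⟩
          obtain ⟨⟨z, s⟩, hz, rfl⟩ := List.mem_map.1 h
          exact ha (List.mem_map.2 ⟨_, hcl z s hz a.1 (hM_symm _ _ hy), rfl⟩)
        have hbe : b = (y, ε a.1 y * a.2) := by
          have hex : ∃ y, M a.1 y ∧ y ∉ (q ++ [a]).map Prod.fst := ⟨y, hy, hyq⟩
          have hch : hex.choose = y := hM_unique _ _ _ hex.choose_spec.1 hy
          have hlast : (q ++ [a]).getLast? = some a := by simp
          rw [hb]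
          simp only [σ, hlast]
          rw [dif_pos hex, hch]
        refine ⟨by simp [hx], fun c s hc d hd => ?_⟩
        simp only [List.append_assoc, List.mem_append, List.mem_singleton] at hc ⊢
        rcases hc with hc | hc | hc
        · exact Or.inl (hcl c s hc d hd)
        · right; right
          subst hc
          rw [hM_unique _ _ _ hd hy, hbe]
        · right; left
          rw [hbe, Prod.mk.injEq] at hc
          obtain ⟨rfl, rfl⟩ := hc
          have hda : d = a.1 := hM_unique _ _ _ hd (hM_symm _ _ hy)
          subst hda
          rw [hε_symm]
          rcases hε a.1 c with h | h <;> simp [h]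
    have hclosed : ∀ c s, (c, s) ∈ p → ∀ d, M c d → (d, ε c d * s) ∈ p := by
      rcases Nat.even_or_odd' p.length with ⟨m, hm | hm⟩
      · exfalso
        obtain ⟨m, rfl⟩ : ∃ m', m = m' + 1 := ⟨m - 1, by omega⟩
        obtain ⟨hx, hcl⟩ := key m (by omega)
        have hlt1 : 2 * m + 1 < p.length := by omega
        have hpe : p = p.take (2 * m + 1) ++ [p[2 * m + 1]] := by
          conv_lhs => rw [← List.take_length (l := p), hm,
            show 2 * (m + 1) = 2 * m + 1 + 1 by ring, List.take_add_one,
            List.getElem?_eq_getElem hlt1]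
          rfl
        generalize p[2 * m + 1] = a at *
        generalize p.take (2 * m + 1) = q at *
        have hnd := hp.1
        rw [hpe] at hnd hall
        have ha : a.1 ∉ q.map Prod.fst := by
          simp only [List.map_append, List.nodup_append] at hnd
          intro h
          exact hnd.2.2 _ h a.1 (by simp) rfl
        have hax : a.1 ≠ x₀ := by
          rintro h
          exact ha (h ▸ List.mem_map_of_mem hx)
        obtain ⟨y, hy⟩ := hM_exists a.1 hax
        have hyq := hall y
        simp only [List.map_append, List.map_cons, List.map_nil, List.mem_append,
          List.mem_singleton] at hyq
        rcases hyq with h | h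
        · obtain ⟨⟨z, s⟩, hz, rfl⟩ := List.mem_map.1 h
          exact ha (List.mem_map.2 ⟨_, hcl z s hz a.1 (hM_symm _ _ hy), rfl⟩)
        · exact hM_irrefl _ (h ▸ hy)
      · have := (key m hm.ge).2
        rwa [← hm, List.take_length] at this
    have hsign : ∀ c, ∃ t, (c, t) ∈ p := fun c => by
      obtain ⟨⟨z, t⟩, hz, rfl⟩ := List.mem_map.1 (hall c)
      exact ⟨t, hz⟩
    choose s hs using hsign
    have hval : ∀ c t, (c, t) ∈ p → t = s c := fun c t hc =>
      congrArg Prod.snd (List.inj_on_of_nodup_map hp.1 hc (hs c) rfl)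
    have hpeq : (p.map Prod.fst).map (fun c => (c, s c)) = p := by
      rw [List.map_map]
      conv_rhs => rw [← List.map_id p]
      refine List.map_congr_left fun m hm => ?_
      obtain ⟨c, t⟩ := m
      simp [← hval c t hm]
    rw [← hpeq]
    exact hP _ s hp.1 hall (fun c => hp.2 _ (hs c)) fun c d hcd =>
      (hval _ _ (hclosed c _ (hs c) d hcd)).symm

end PairingStrategy

/-- The phase of a rational tangle word at the start of a syllable: the syllable is an SI
syllable, or it is the first syllable of an NSI run, or the connectivity state is `X`. -/
inductive Phase : Type
  | si
  | entry
  | cross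
  deriving DecidableEq

/-- The phase after a syllable of the given size. -/
def Phase.next : Phase → ℕ → Phase
  | .si, _ => .entry
  | .entry, a => if Even a then .si else .cross
  | .cross, a => if Even a then .cross else .si

/-- The phase at the start of the `i`-th syllable of the word with syllable sizes `n`. -/
def phase (n : List ℕ) : ℕ → Phase
  | 0 => .entry
  | i + 1 => (phase n i).next (n.getD i 0)

/-- The connectivity state corresponding to a phase at the start of the `i`-th syllable. -/
def Phase.toState (i : ℕ) : Phase → TState
  | .si => if i % 2 = 0 then .H else .V
  | .entry => if i % 2 = 0 then .V else .H
  | .cross => .X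

theorem step_involutive (b : Bool) : Function.Involutive (step b) := by
  intro s
  cases b <;> cases s <;> rfl

theorem runWord_append_singleton (u : List ℤ) (a : ℤ) (b : Bool) (s : TState) :
    runWord (u ++ [a]) b s =
      (step (if u.length % 2 = 0 then b else !b))^[a.natAbs] (runWord u b s) := by
  induction u generalizing b s with
  | nil => simp [runWord]
  | cons x u ih =>
    simp only [List.cons_append, runWord, ih, List.length_cons]
    congr 2
    rcases Nat.mod_two_eq_zero_or_one u.length with h | h <;> simp [h, Nat.add_mod]

theorem natWord_eq_map (n : List ℕ) : natWord n = n.map (Nat.cast : ℕ → ℤ) := by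
  simp [natWord, List.map_eq_flatMap]

theorem stateAt_natWord (n : List ℕ) (i : ℕ) (hi : i ≤ n.length) :
    stateAt (natWord n) i = (phase n i).toState i := by
  induction i with
  | zero => rfl
  | succ i ih =>
    have hlt : i < n.length := hi
    have htake : (natWord n).take (i + 1) = (natWord n).take i ++ [((n.getD i 0 : ℕ) : ℤ)] := by
      rw [List.take_add_one]
      simp [natWord_eq_map, hlt]
    have hlen : ((natWord n).take i).length = i := by simp [natWord_eq_map, hlt.le]
    have ih' : runWord ((natWord n).take i) true TState.V = _ := ih hlt.le
    rw [stateAt, htake, runWord_append_singleton, ih', hlen, Int.natAbs_natCast, phase]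
    generalize n.getD i 0 = a
    generalize phase n i = q
    rcases Nat.even_or_odd a with ha | ha
    · rw [(step_involutive _).iterate_even ha]
      rcases Nat.mod_two_eq_zero_or_one i with h | h <;> cases q <;>
        simp [Phase.next, Phase.toState, h, ha, Nat.add_mod]
    · rw [(step_involutive _).iterate_odd ha]
      rcases Nat.mod_two_eq_zero_or_one i with h | h <;> cases q <;>
        simp [Phase.next, Phase.toState, h, Nat.not_even_iff_odd.2 ha, Nat.add_mod, step, bstep,
          rstep]

theorem isSISyl_natWord_iff (n : List ℕ) (i : ℕ) (hi : i ≤ n.length) :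
    IsSISyl (natWord n) i ↔ phase n i = .si := by
  rw [IsSISyl, stateAt_natWord n i hi, siState]
  generalize phase n i = q
  rcases Nat.mod_two_eq_zero_or_one i with h | h <;> cases q <;> simp [Phase.toState, h]

theorem odd_sum_nsi_iff (n : List ℕ) (i : ℕ) :
    Odd (∑ j ∈ Finset.range i, if phase n j = .si then 0 else n.getD j 0) ↔
      phase n i = .cross := by
  induction i with
  | zero => simp [phase]
  | succ i ih =>
    rw [Finset.sum_range_succ, Nat.odd_add, ih, phase]
    generalize n.getD i 0 = a
    generalize phase n i = q
    by_cases ha : Even a <;> cases q <;> simp [Phase.next, ha]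

theorem nsiCrossings_natWord (n : List ℕ) :
    nsiCrossings (natWord n) =
      ∑ j ∈ Finset.range n.length, if phase n j = .si then 0 else n.getD j 0 := by
  have hlen : (natWord n).length = n.length := by simp [natWord_eq_map]
  rw [nsiCrossings, hlen]
  refine Finset.sum_congr rfl fun i hi => ?_
  have hi := Finset.mem_range.1 hi
  simp only [isSISyl_natWord_iff n i hi.le]
  simp [natWord_eq_map, hi]

theorem siCrossings_natWord (n : List ℕ) :
    siCrossings (natWord n) =
      ∑ j ∈ Finset.range n.length, if phase n j = .si then n.getD j 0 else 0 := by
  have hlen : (natWord n).length = n.length := by simp [natWord_eq_map]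
  rw [siCrossings, hlen]
  refine Finset.sum_congr rfl fun i hi => ?_
  have hi := Finset.mem_range.1 hi
  simp only [isSISyl_natWord_iff n i hi.le]
  simp [natWord_eq_map, hi]

/-- The odd syllables `i < j` are the two odd syllables of one NSI run. -/
def OddPartners (n : List ℕ) (i j : ℕ) : Prop :=
  i < j ∧ phase n i = .entry ∧ Odd (n.getD i 0) ∧ phase n j = .cross ∧ Odd (n.getD j 0) ∧
    ∀ t, i < t → t < j → Even (n.getD t 0)

theorem OddPartners.right_unique {n : List ℕ} {i j j' : ℕ} (h : OddPartners n i j)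
    (h' : OddPartners n i j') : j = j' := by
  obtain ⟨hij, -, -, -, hj, hb⟩ := h
  obtain ⟨hij', -, -, -, hj', hb'⟩ := h'
  rcases lt_trichotomy j j' with hlt | heq | hlt
  · exact absurd (hb' j hij hlt) (Nat.not_even_iff_odd.2 hj)
  · exact heq
  · exact absurd (hb j' hij' hlt) (Nat.not_even_iff_odd.2 hj')

theorem OddPartners.left_unique {n : List ℕ} {i i' j : ℕ} (h : OddPartners n i j)
    (h' : OddPartners n i' j) : i = i' := by
  obtain ⟨hij, -, hi, -, -, hb⟩ := h
  obtain ⟨hij', -, hi', -, -, hb'⟩ := h'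
  rcases lt_trichotomy i i' with hlt | heq | hlt
  · exact absurd (hb i' hlt hij') (Nat.not_even_iff_odd.2 hi')
  · exact heq
  · exact absurd (hb' i hlt hij) (Nat.not_even_iff_odd.2 hi)

theorem exists_odd_before {n : List ℕ} {i : ℕ} (h : phase n i = .cross) :
    ∃ o < i, phase n o = .entry ∧ Odd (n.getD o 0) ∧ ∀ t, o < t → t < i → Even (n.getD t 0) := by
  induction i with
  | zero => simp [phase] at h
  | succ i ih =>
    rw [phase] at h
    cases hq : phase n i with
    | si => simp [hq, Phase.next] at h
    | entry =>
      simp only [hq, Phase.next, ite_eq_right_iff, reduceCtorEq, imp_false,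
        Nat.not_even_iff_odd] at h
      exact ⟨i, i.lt_succ_self, hq, h, fun t h1 h2 => by omega⟩
    | cross =>
      have he : Even (n.getD i 0) := by
        by_contra hne
        simp only [hq, Phase.next, hne] at h
        simp at h
      obtain ⟨o, ho, h1, h2, h3⟩ := ih hq
      refine ⟨o, by omega, h1, h2, fun t ht1 ht2 => ?_⟩
      rcases Nat.lt_succ_iff_lt_or_eq.1 ht2 with h | rfl
      exacts [h3 t ht1 h, he]

theorem exists_odd_after {n : List ℕ} {i : ℕ} (k : ℕ) (hik : i ≤ k) (h : phase n i = .cross)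
    (hk : phase n k ≠ .cross) :
    ∃ j, i ≤ j ∧ j < k ∧ phase n j = .cross ∧ Odd (n.getD j 0) ∧
      ∀ t, i ≤ t → t < j → Even (n.getD t 0) := by
  induction hm : k - i generalizing i with
  | zero =>
    obtain rfl : i = k := by omega
    exact absurd h hk
  | succ m ih =>
    rcases Nat.even_or_odd (n.getD i 0) with he | ho
    · have h' : phase n (i + 1) = .cross := by
        simp only [phase, h, Phase.next, he, if_true]
      obtain ⟨j, h1, h2, h3, h4, h5⟩ := ih (by omega) h' (by omega)
      refine ⟨j, by omega, h2, h3, h4, fun t ht1 ht2 => ?_⟩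
      rcases eq_or_lt_of_le ht1 with rfl | h
      exacts [he, h5 t h ht2]
    · exact ⟨i, le_rfl, by omega, h, ho, fun t h1 h2 => by omega⟩

namespace TEq

theorem zero_cons_cons (a : ℤ) (t : List ℤ) : TEq (0 :: a :: t) (0 :: 0 :: t) := by
  induction a using Int.induction_on with
  | zero => exact refl _
  | succ a ih => exact (move3 _ t).trans ih
  | pred a ih =>
    have := move3 (-(a : ℤ) - 1) t
    rw [sub_add_cancel] at this
    exact this.symm.trans ih

theorem zero_cons_cons_of_ne_nil (a : ℤ) {t : List ℤ} (ht : t ≠ []) : TEq (0 :: a :: t) t :=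
  (zero_cons_cons a t).trans (move2 [] t ht)

theorem zero_pair (a : ℤ) : TEq [0, a] [0] :=
  (zero_cons_cons a []).trans (move0 [0] (by simp))

theorem unit_cons_cons {e : ℤ} (he : e = 1 ∨ e = -1) (a : ℤ) (t : List ℤ) :
    TEq (e :: a :: t) ((a + e) :: t) := by
  rcases he with rfl | rfl
  exacts [move4 a t, move5 a t]

/-- Left-to-right reduction of a word in which, before position `D`, the even NSI syllables are
zero and the two odd syllables of each NSI run are opposite units. -/
theorem reduction_before {n : List ℕ} {w : List ℤ} (hw : w.length = n.length) {D : ℕ}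
    (hD : D ≤ n.length)
    (heven : ∀ i < D, phase n i ≠ .si → Even (n.getD i 0) → w.getD i 0 = 0)
    (hodd : ∀ i < D, phase n i = .entry → Odd (n.getD i 0) →
      w.getD i 0 = 1 ∨ w.getD i 0 = -1)
    (hpair : ∀ i j, OddPartners n i j → j < D → w.getD j 0 = - w.getD i 0)
    (i : ℕ) (hi : i ≤ D) :
    (phase n i = .entry → i < n.length → TEq w (w.drop i)) ∧
    (phase n i = .si → TEq w (0 :: w.drop i)) ∧
    (∀ o < i, phase n o = .entry → Odd (n.getD o 0) → (∀ t, o < t → t < i → Even (n.getD t 0)) →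
      TEq w (w.getD o 0 :: w.drop i)) := by
  induction i with
  | zero => exact ⟨fun _ _ => refl _, fun h => by simp [phase] at h, fun o ho => by omega⟩
  | succ i ih =>
    obtain ⟨ih1, ih2, ih3⟩ := ih (by omega)
    have hdrop : w.drop i = w.getD i 0 :: w.drop (i + 1) := by
      have hiw : i < w.length := by omega
      rw [List.drop_eq_getElem_cons hiw]
      simp [hiw]
    rw [hdrop] at ih1 ih2 ih3
    refine ⟨fun h hlt => ?_, fun h => ?_, fun o ho h1 h2 h3 => ?_⟩
    · have hq : phase n i = .si := by
        rw [phase] at h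
        revert h
        generalize phase n i = q
        by_cases he : Even (n.getD i 0) <;> cases q <;> simp only [Phase.next, he] <;> simp
      refine (ih2 hq).trans (zero_cons_cons_of_ne_nil _ ?_)
      rw [Ne, List.drop_eq_nil_iff]
      omega
    · cases hq : phase n i with
      | si => simp [phase, hq, Phase.next] at h
      | entry =>
        have he : Even (n.getD i 0) := by
          by_contra hne
          simp only [phase, hq, Phase.next, hne] at h
          simp at h
        have := ih1 hq (by omega)
        rwa [heven i hi (by simp [hq]) he] at this
      | cross =>
        have hodd_i : Odd (n.getD i 0) := by
          by_contra hne
          rw [Nat.not_odd_iff_even] at hne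
          simp only [phase, hq, Phase.next, hne] at h
          simp at h
        obtain ⟨o, ho, h1, h2, h3⟩ := exists_odd_before hq
        have hp : OddPartners n o i := ⟨ho, h1, h2, hq, hodd_i, h3⟩
        have := (ih3 o ho h1 h2 h3).trans (unit_cons_cons (hodd o (by omega) h1 h2) _ _)
        rwa [hpair o i hp hi, neg_add_cancel] at this
    · rcases Nat.lt_succ_iff_lt_or_eq.1 ho with hlt | rfl
      · have hne : phase n i ≠ .si := by
          have hcr : ∀ t, o < t → t ≤ i → phase n t = .cross := by
            intro t ht
            induction t, ht using Nat.le_induction with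
            | base =>
              intro _
              rw [Nat.succ_eq_add_one, phase, h1, Phase.next, if_neg (Nat.not_even_iff_odd.2 h2)]
            | succ t ht iht =>
              intro hti
              rw [phase, iht (by omega), Phase.next, if_pos (h3 t ht (by omega))]
          simp [hcr i hlt le_rfl]
        have := (ih3 o hlt h1 h2 fun t ht1 ht2 => h3 t ht1 (by omega)).trans
          (unit_cons_cons (hodd o (by omega) h1 h2) _ _)
        rwa [heven i hi hne (h3 i hlt (by omega)), zero_add] at this
      · exact ih1 h1 (by omega)

end TEq

theorem sum_eq_zero_of_rev {m : ℕ} (f : Fin m → ℤ) (T : Finset (Fin m))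
    (hT : ∀ j ∈ T, j.rev ∈ T) (hne : ∀ j ∈ T, j.rev ≠ j) (hf : ∀ j ∈ T, f j.rev = -f j) :
    ∑ j ∈ T, f j = 0 :=
  Finset.sum_involution (fun j _ => j.rev) (fun j hj => by rw [hf j hj, add_neg_cancel])
    (fun j hj _ => hne j hj) hT (fun j _ => Fin.rev_rev j)

theorem sum_eq_zero_of_rev_of_even {m : ℕ} (hm : Even m) (f : Fin m → ℤ)
    (hf : ∀ j, j.rev ≠ j → f j.rev = -f j) : ∑ j, f j = 0 := by
  have hne : ∀ j : Fin m, j.rev ≠ j := fun j h => by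
    obtain ⟨r, hr⟩ := hm
    have := congrArg Fin.val h
    rw [Fin.val_rev] at this
    omega
  exact sum_eq_zero_of_rev f _ (by simp) (fun j _ => hne j) fun j _ => hf j (hne j)

theorem sum_eq_middle_of_rev {m : ℕ} (f : Fin m → ℤ) (c : Fin m) (hc : 2 * (c : ℕ) + 1 = m)
    (hf : ∀ j, j.rev ≠ j → f j.rev = -f j) : ∑ j, f j = f c := by
  have hne : ∀ j : Fin m, j ≠ c → j.rev ≠ j := fun j hj h => by
    have := congrArg Fin.val h
    rw [Fin.val_rev] at this
    exact hj (Fin.ext (by omega))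
  have hcr : c.rev = c := Fin.ext (by rw [Fin.val_rev]; omega)
  rw [← Finset.add_sum_erase _ _ (Finset.mem_univ c), sum_eq_zero_of_rev, add_zero]
  · intro j hj
    simp only [Finset.mem_erase, Finset.mem_univ, and_true] at hj ⊢
    rwa [Ne, Fin.rev_eq_iff, hcr]
  · exact fun j hj => hne j (Finset.ne_of_mem_erase hj)
  · exact fun j hj => hf j (hne j (Finset.ne_of_mem_erase hj))

theorem sum_eq_two_mul_of_rev {m : ℕ} (hm : Even m) (f : Fin m → ℤ) (c : Fin m)
    (hc : f c.rev = f c) (hf : ∀ j, j ≠ c → j ≠ c.rev → f j.rev = -f j) :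
    ∑ j, f j = 2 * f c := by
  have hne : ∀ j : Fin m, j.rev ≠ j := fun j h => by
    obtain ⟨r, hr⟩ := hm
    have := congrArg Fin.val h
    rw [Fin.val_rev] at this
    omega
  rw [← Finset.add_sum_erase _ _ (Finset.mem_univ c), ← Finset.add_sum_erase _ _
    (Finset.mem_erase.2 ⟨hne c, Finset.mem_univ _⟩), hc, sum_eq_zero_of_rev]
  · ring
  · intro j hj
    simp only [Finset.mem_erase, Finset.mem_univ, and_true] at hj ⊢
    exact ⟨fun h => hj.2 (Fin.rev_injective h), fun h => hj.1 (Fin.rev_eq_iff.1 h)⟩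
  · exact fun j _ => hne j
  · intro j hj
    simp only [Finset.mem_erase, Finset.mem_univ, and_true] at hj
    exact hf j hj.2 hj.1

theorem exists_involutive_of_odd_card {A : Type*} [Fintype A] (h : Odd (Fintype.card A)) :
    ∃ (a : A) (τ : A → A), Function.Involutive τ ∧ ∀ x, τ x = x ↔ x = a := by
  obtain ⟨r, hr⟩ := h
  let e := Fintype.equivFin A
  refine ⟨e.symm ⟨r, by omega⟩, fun x => e.symm (e x).rev, fun x => by simp, fun x => ?_⟩
  rw [Equiv.symm_apply_eq, Equiv.eq_symm_apply, Fin.ext_iff, Fin.ext_iff, Fin.val_rev]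
  change _ ↔ (e x : ℕ) = r
  omega

theorem getD_fin (n : List ℕ) (i : Fin n.length) : n.getD i 0 = n.get i := by
  simp

theorem crossing_ext {n : List ℕ} {c d : Cr n} (h₁ : (c.1 : ℕ) = d.1) (h₂ : (c.2 : ℕ) = d.2) :
    c = d := by
  obtain ⟨i, j⟩ := c
  obtain ⟨i', j'⟩ := d
  obtain rfl : i = i' := Fin.ext h₁
  obtain rfl : j = j' := Fin.ext h₂
  rfl

/-- The middle crossing of an odd syllable. -/
def middle (n : List ℕ) (i : ℕ) (hi : i < n.length) (ho : Odd (n.getD i 0)) : Cr n :=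
  ⟨⟨i, hi⟩, ⟨n.getD i 0 / 2, by
    rw [← getD_fin]
    exact Nat.div_lt_self ho.pos one_lt_two⟩⟩

theorem two_mul_middle_add_one (n : List ℕ) (i : ℕ) (hi : i < n.length)
    (ho : Odd (n.getD i 0)) : 2 * ((middle n i hi ho).2 : ℕ) + 1 = n.getD i 0 :=
  Nat.two_mul_div_two_add_one_of_odd ho

/-- The pairing of NSI crossings: crossings symmetric about the centre of one syllable are
paired, and the middle crossings of the two odd syllables of an NSI run are paired. -/
def NSIPaired (n : List ℕ) (c d : Cr n) : Prop :=
  (phase n c.1 ≠ .si ∧ (c.1 : ℕ) = d.1 ∧ (c.2 : ℕ) + d.2 + 1 = n.getD c.1 0 ∧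
      (c.2 : ℕ) ≠ d.2) ∨
    ((OddPartners n c.1 d.1 ∨ OddPartners n d.1 c.1) ∧
      2 * (c.2 : ℕ) + 1 = n.getD c.1 0 ∧ 2 * (d.2 : ℕ) + 1 = n.getD d.1 0)

namespace NSIPaired

variable {n : List ℕ} {c d d' : Cr n}

theorem symm (h : NSIPaired n c d) : NSIPaired n d c := by
  rcases h with ⟨h1, h2, h3, h4⟩ | ⟨h1, h2, h3⟩
  · exact Or.inl ⟨h2 ▸ h1, h2.symm, by rw [← h2]; omega, h4.symm⟩
  · exact Or.inr ⟨h1.symm, h3, h2⟩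

theorem ne_si (h : NSIPaired n c d) : phase n c.1 ≠ .si := by
  rcases h with h | ⟨h1 | h1, -⟩
  · exact h.1
  · simp [h1.2.1]
  · simp [h1.2.2.2.1]

theorem irrefl (c : Cr n) : ¬ NSIPaired n c c := by
  rintro (h | ⟨h1 | h1, -⟩)
  · exact h.2.2.2 rfl
  · exact h1.1.false
  · exact h1.1.false

theorem unique (h : NSIPaired n c d) (h' : NSIPaired n c d') : d = d' := by
  rcases h with ⟨-, h2, h3, h4⟩ | ⟨h1, h2, h3⟩ <;>
    rcases h' with ⟨-, h2', h3', h4'⟩ | ⟨h1', h2', h3'⟩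
  · exact crossing_ext (by omega) (by omega)
  · omega
  · omega
  · have hd : (d.1 : ℕ) = d'.1 := by
      rcases h1 with h1 | h1 <;> rcases h1' with h1' | h1'
      · exact h1.right_unique h1'
      · simpa [h1.2.1] using h1'.2.2.2.1
      · simpa [h1.2.2.2.1] using h1'.2.1
      · exact h1.left_unique h1'
    rw [← hd] at h3'
    exact crossing_ext hd (by omega)

theorem exists_of_ne_si (hend : phase n n.length ≠ .cross) (c : Cr n) (hc : phase n c.1 ≠ .si) :
    ∃ d, NSIPaired n c d := by
  have hlt := c.2.isLt
  have hget := getD_fin n c.1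
  by_cases hmid : 2 * (c.2 : ℕ) + 1 = n.getD c.1 0
  · have ho : Odd (n.getD c.1 0) := ⟨_, hmid.symm⟩
    cases hq : phase n c.1 with
    | si => exact absurd hq hc
    | entry =>
      have hnext : phase n (c.1 + 1) = .cross := by
        rw [phase, hq, Phase.next, if_neg (Nat.not_even_iff_odd.2 ho)]
      obtain ⟨j, h1, h2, h3, h4, h5⟩ := exists_odd_after n.length c.1.isLt hnext hend
      exact ⟨middle n j h2 h4, Or.inr ⟨Or.inl ⟨h1, hq, ho, h3, h4, h5⟩, hmid,
        two_mul_middle_add_one n j h2 h4⟩⟩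
    | cross =>
      obtain ⟨o, h1, h2, h3, h4⟩ := exists_odd_before hq
      have ho' : o < n.length := h1.trans c.1.isLt
      exact ⟨middle n o ho' h3, Or.inr ⟨Or.inr ⟨h1, h2, h3, hq, ho, h4⟩, hmid,
        two_mul_middle_add_one n o ho' h3⟩⟩
  · refine ⟨⟨c.1, c.2.rev⟩, Or.inl ⟨hc, rfl, ?_, ?_⟩⟩
    all_goals
      simp only [Fin.val_rev]
      omega

end NSIPaired

theorem card_si_crossings (n : List ℕ) :
    Fintype.card {c : Cr n // phase n c.1 = .si} = siCrossings (natWord n) := by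
  rw [siCrossings_natWord, ← Fin.sum_univ_eq_sum_range
    (fun j => if phase n j = .si then n.getD j 0 else 0), Fintype.card_subtype,
    Finset.card_filter, Finset.univ_sigma_univ.symm, Finset.sum_sigma]
  refine Finset.sum_congr rfl fun i _ => ?_
  by_cases h : phase n i = .si <;> simp [h]

/-- The word determined by an assignment of signs to all crossings. -/
def signWord (n : List ℕ) (s : Cr n → ℤ) : List ℤ :=
  (List.finRange n.length).map fun i => ∑ j, s ⟨i, j⟩

theorem length_signWord (n : List ℕ) (s : Cr n → ℤ) : (signWord n s).length = n.length := by
  simp [signWord]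

theorem getD_signWord (n : List ℕ) (s : Cr n → ℤ) (i : Fin n.length) :
    (signWord n s).getD i 0 = ∑ j, s ⟨i, j⟩ := by
  have hi : (List.finRange n.length)[(i : ℕ)]'(by simp) = i := by simp
  simpa [signWord] using congrArg (fun i => ∑ j, s ⟨i, j⟩) hi

theorem result_map_eq_signWord (n : List ℕ) (L : List (Cr n)) (s : Cr n → ℤ) (hL : L.Nodup)
    (hall : ∀ c, c ∈ L) : result n (L.map fun c => (c, s c)) = signWord n s := by
  refine List.map_congr_left fun i _ => ?_
  have h : (((L.map fun c => (c, s c)).filter fun m => decide (m.1.1 = i)).map Prod.snd) =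
      (L.filter fun c => decide (c.1 = i)).map s := by
    rw [List.filter_map, List.map_map]
    rfl
  rw [h, ← List.sum_toFinset s (hL.filter _)]
  have huniv : L.toFinset = Finset.univ := by
    ext c
    simp [hall c]
  rw [List.toFinset_filter, huniv, Finset.sum_filter, Finset.univ_sigma_univ.symm,
    Finset.sum_sigma, Finset.sum_eq_single i]
  · simp
  · intro b _ hb
    simp [hb]
  · simp

/-- Paired NSI crossings carry opposite signs, except that the designated crossing, if any, and
its partner carry equal signs. -/
def ResolvesPairs (n : List ℕ) (x : Option (Cr n)) (s : Cr n → ℤ) : Prop :=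
  (∀ c, s c = 1 ∨ s c = -1) ∧ ∀ c d, NSIPaired n c d →
    s d = (if x = some c ∨ x = some d then 1 else -1) * s c

theorem canForce_of_resolvesPairs {n : List ℕ} (hsi : Odd (siCrossings (natWord n)))
    (hend : phase n n.length ≠ .cross) (x : Option (Cr n)) (P : List ℤ → Prop)
    (hP : ∀ s, ResolvesPairs n x s → P (signWord n s)) :
    CanForce (C := Cr n) 0 (fun p => P (result n p)) := by
  rw [← card_si_crossings] at hsi
  obtain ⟨a, τ, hτ, hfix⟩ := exists_involutive_of_odd_card hsi
  refine canForce_of_pairing a.1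
    (fun c d => NSIPaired n c d ∨ ∃ (hc : phase n c.1 = .si) (hd : phase n d.1 = .si),
      c ≠ d ∧ τ ⟨c, hc⟩ = ⟨d, hd⟩)
    (fun c d => if x = some c ∨ x = some d then 1 else -1) _ ?_ ?_ ?_ ?_ ?_ ?_ ?_ ?_
  · rintro c d (h | ⟨hc, hd, hne, h⟩)
    · exact Or.inl h.symm
    · exact Or.inr ⟨hd, hc, hne.symm, by rw [← h, hτ]⟩
  · rintro c (h | ⟨hc, hd, hne, h⟩)
    · exact NSIPaired.irrefl c h
    · exact hne rfl
  · rintro c d d' (h | ⟨hc, hd, hne, h⟩) (h' | ⟨hc', hd', hne', h'⟩)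
    · exact h.unique h'
    · exact absurd hc' h.ne_si
    · exact absurd hc h'.ne_si
    · exact congrArg Subtype.val (h.symm.trans h')
  · intro c hca
    by_cases hc : phase n c.1 = .si
    · refine ⟨(τ ⟨c, hc⟩).1, Or.inr ⟨hc, (τ ⟨c, hc⟩).2, fun h => hca ?_, rfl⟩⟩
      exact congrArg Subtype.val ((hfix ⟨c, hc⟩).1 (Subtype.ext h.symm))
    · obtain ⟨d, hd⟩ := NSIPaired.exists_of_ne_si hend c hc
      exact ⟨d, Or.inl hd⟩
  · rintro d (h | ⟨hc, hd, hne, h⟩)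
    · exact h.ne_si a.2
    · rw [(hfix _).2 rfl] at h
      exact hne (congrArg Subtype.val h)
  · intro c d
    split_ifs <;> simp
  · intro c d
    simp only [or_comm]
  · intro L s hL hall hs hM
    simp only [result_map_eq_signWord n L s hL hall]
    exact hP s ⟨hs, fun c d h => hM c d (Or.inl h)⟩

namespace ResolvesPairs

variable {n : List ℕ} {x : Option (Cr n)} {s : Cr n → ℤ}

theorem apply_rev (h : ResolvesPairs n x s) {i : Fin n.length} (hi : phase n i ≠ .si)
    (j : Fin (n.get i)) (hj : j.rev ≠ j) (hx : x ≠ some ⟨i, j⟩) (hx' : x ≠ some ⟨i, j.rev⟩) :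
    s ⟨i, j.rev⟩ = -s ⟨i, j⟩ := by
  have hne : (j.rev : ℕ) ≠ j := fun h => hj (Fin.ext h)
  have hadd : (j : ℕ) + j.rev + 1 = n.get i := by
    have := j.isLt
    rw [Fin.val_rev]
    omega
  rw [h.2 ⟨i, j⟩ ⟨i, j.rev⟩ (Or.inl ⟨hi, rfl, hadd.trans (getD_fin n i).symm, hne.symm⟩),
    if_neg (by simp [hx, hx'])]
  ring

theorem getD_of_even (h : ResolvesPairs n x s) (i : Fin n.length) (hi : phase n i ≠ .si)
    (he : Even (n.getD i 0)) (hx : ∀ j, x ≠ some ⟨i, j⟩) : (signWord n s).getD i 0 = 0 := by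
  rw [getD_signWord]
  rw [getD_fin] at he
  exact sum_eq_zero_of_rev_of_even he _ fun j hj => h.apply_rev hi j hj (hx _) (hx _)

theorem getD_middle (h : ResolvesPairs n x s) (c : Cr n) (hi : phase n c.1 ≠ .si)
    (hc : 2 * (c.2 : ℕ) + 1 = n.getD c.1 0) (hx : ∀ j, j ≠ c.2 → x ≠ some ⟨c.1, j⟩) :
    (signWord n s).getD c.1 0 = s c := by
  rw [getD_signWord]
  rw [getD_fin] at hc
  refine sum_eq_middle_of_rev _ c.2 hc fun j hj => h.apply_rev hi j hj (hx _ ?_) (hx _ ?_)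
  all_goals
    rintro hjc
    have := congrArg Fin.val hjc
    refine hj (Fin.ext ?_)
    simp only [Fin.val_rev] at this ⊢
    omega

theorem reduction_before (h : ResolvesPairs n x s) {D : ℕ} (hD : D ≤ n.length)
    (hx : ∀ c, x = some c → D ≤ c.1) :
    (phase n D = .entry → D < n.length → TEq (signWord n s) ((signWord n s).drop D)) ∧
    (phase n D = .si → TEq (signWord n s) (0 :: (signWord n s).drop D)) ∧
    (∀ o < D, phase n o = .entry → Odd (n.getD o 0) → (∀ t, o < t → t < D → Even (n.getD t 0)) →
      TEq (signWord n s) ((signWord n s).getD o 0 :: (signWord n s).drop D)) := by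
  have hx' : ∀ c : Cr n, (c.1 : ℕ) < D → x ≠ some c := fun c hc hcx => by
    have := hx c hcx
    omega
  have hmid : ∀ i (hi : i < D) (ho : Odd (n.getD i 0)), phase n i ≠ .si →
      (signWord n s).getD i 0 = s (middle n i (hi.trans_le hD) ho) := fun i hi ho hq =>
    h.getD_middle (middle n i (hi.trans_le hD) ho) hq (two_mul_middle_add_one n i _ ho)
      fun j _ => hx' _ hi
  refine TEq.reduction_before (length_signWord n s) hD ?_ ?_ ?_ D le_rfl
  · exact fun i hi hq he => h.getD_of_even ⟨i, hi.trans_le hD⟩ hq he fun j => hx' _ hi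
  · intro i hi hq ho
    rw [hmid i hi ho (by simp [hq])]
    exact h.1 _
  · intro i j hij hj
    have hi : i < D := hij.1.trans hj
    have hin := hi.trans_le hD
    have hjn := hj.trans_le hD
    have ho := hij.2.2.1
    have ho' := hij.2.2.2.2.1
    have hx₁ : x ≠ some (middle n i hin ho) := hx' _ hi
    have hx₂ : x ≠ some (middle n j hjn ho') := hx' _ hj
    rw [hmid i hi ho (by simp [hij.2.1]), hmid j hj ho' (by simp [hij.2.2.2.1]),
      h.2 _ _ (Or.inr ⟨Or.inl hij, two_mul_middle_add_one n i hin ho,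
        two_mul_middle_add_one n j hjn ho'⟩), if_neg (by simp [hx₁, hx₂])]
    ring

theorem reduces_to_zero (h : ResolvesPairs n none s) (hne : n ≠ [])
    (hend : phase n n.length ≠ .cross) : TEq (signWord n s) [0] := by
  cases hq : phase n n.length with
  | cross => exact absurd hq hend
  | si =>
    have := (h.reduction_before le_rfl (by simp)).2.1 hq
    rwa [List.drop_of_length_le (length_signWord n s).le] at this
  | entry =>
    obtain ⟨m, hm⟩ : ∃ m, n.length = m + 1 :=
      ⟨n.length - 1, by have := List.length_pos_iff.2 hne; omega⟩
    have hsi : phase n m = .si := by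
      rw [hm, phase] at hq
      revert hq
      generalize phase n m = q
      by_cases he : Even (n.getD m 0) <;> cases q <;> simp only [Phase.next, he] <;> simp
    have hlt : m < (signWord n s).length := by rw [length_signWord]; omega
    have := (h.reduction_before (D := m) (by omega) (by simp)).2.1 hsi
    rw [List.drop_eq_getElem_cons hlt, List.drop_of_length_le
      (by rw [length_signWord]; omega)] at this
    exact this.trans (TEq.zero_pair _)

theorem reduces_to_two_of_equiv {d : ℕ} (hlast : n.length ≤ d + 2) {e : ℤ}
    (he : e = 1 ∨ e = -1)
    (hw : TEq (signWord n s) ((2 * e) :: (signWord n s).drop (d + 1))) :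
    TEq (signWord n s) [2] ∨ TEq (signWord n s) [-2] ∨
      ∃ c : ℤ, TEq (signWord n s) [2, c] ∨ TEq (signWord n s) [-2, c] := by
  have hlen := length_signWord n s
  rcases Nat.lt_or_ge (d + 1) (signWord n s).length with hlt | hge
  · rw [List.drop_eq_getElem_cons hlt, List.drop_of_length_le (by omega)] at hw
    rcases he with rfl | rfl
    · exact Or.inr (Or.inr ⟨_, Or.inl hw⟩)
    · exact Or.inr (Or.inr ⟨_, Or.inr hw⟩)
  · rw [List.drop_of_length_le hge] at hw
    rcases he with rfl | rfl
    · exact Or.inl hw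
    · exact Or.inr (Or.inl hw)

theorem reduces_to_two_of_entry {d : ℕ} (hdn : d < n.length) (hlast : n.length ≤ d + 2)
    (hq : phase n d = .entry) (he : Even (n.getD d 0)) (hpos : 0 < n.get ⟨d, hdn⟩)
    (h : ResolvesPairs n (some ⟨⟨d, hdn⟩, ⟨0, hpos⟩⟩) s) :
    TEq (signWord n s) [2] ∨ TEq (signWord n s) [-2] ∨
      ∃ c : ℤ, TEq (signWord n s) [2, c] ∨ TEq (signWord n s) [-2, c] := by
  have hget : n.getD d 0 = n.get ⟨d, hdn⟩ := getD_fin n ⟨d, hdn⟩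
  have he' : Even (n.get ⟨d, hdn⟩) := hget ▸ he
  have hval : (signWord n s).getD d 0 = 2 * s ⟨⟨d, hdn⟩, ⟨0, hpos⟩⟩ := by
    rw [getD_signWord n s ⟨d, hdn⟩]
    refine sum_eq_two_mul_of_rev he' _ ⟨0, hpos⟩ ?_ ?_
    · rw [h.2 ⟨⟨d, hdn⟩, ⟨0, hpos⟩⟩ ⟨⟨d, hdn⟩, Fin.rev ⟨0, hpos⟩⟩
          (Or.inl ⟨by simp [hq], rfl, ?_, ?_⟩),
        if_pos (Or.inl rfl), one_mul]
      all_goals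
        obtain ⟨r, hr⟩ := he'
        simp only [Fin.val_rev]
        omega
    · intro j hj hj'
      have hne : j.rev ≠ j := fun hr => by
        obtain ⟨r, hr'⟩ := he'
        have := congrArg Fin.val hr
        rw [Fin.val_rev] at this
        omega
      refine h.apply_rev (by simp [hq]) j hne ?_ ?_
      · intro hx
        simp only [Option.some.injEq, Sigma.mk.injEq, heq_eq_eq, true_and] at hx
        exact hj hx.symm
      · intro hx
        simp only [Option.some.injEq, Sigma.mk.injEq, heq_eq_eq, true_and] at hx
        exact hj' (Fin.rev_eq_iff.1 hx.symm)
  have hlt : d < (signWord n s).length := by rwa [length_signWord]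
  have hw := (h.reduction_before hdn.le (by rintro c ⟨rfl⟩; exact le_rfl)).1 hq hdn
  rw [List.drop_eq_getElem_cons hlt, ← List.getD_eq_getElem _ 0 hlt, hval] at hw
  exact reduces_to_two_of_equiv hlast (h.1 _) hw

theorem reduces_to_two_of_cross {d : ℕ} (hdn : d < n.length) (hlast : n.length ≤ d + 2)
    (hq : phase n d = .cross) (ho : Odd (n.getD d 0))
    (h : ResolvesPairs n (some (middle n d hdn ho)) s) :
    TEq (signWord n s) [2] ∨ TEq (signWord n s) [-2] ∨
      ∃ c : ℤ, TEq (signWord n s) [2, c] ∨ TEq (signWord n s) [-2, c] := by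
  obtain ⟨o, hod, hoq, hoo, hbetween⟩ := exists_odd_before hq
  have hon := hod.trans hdn
  have hvald : (signWord n s).getD d 0 = s (middle n d hdn ho) := by
    refine h.getD_middle (middle n d hdn ho) (by simp [middle, hq])
      (two_mul_middle_add_one n d hdn ho) fun j hj hx => hj ?_
    exact eq_of_heq (Sigma.mk.inj (Option.some.inj hx).symm).2
  have hvalo : (signWord n s).getD o 0 = s (middle n o hon hoo) := by
    refine h.getD_middle (middle n o hon hoo) (by simp [middle, hoq])
      (two_mul_middle_add_one n o hon hoo) fun j _ hx => ?_
    have := congrArg (fun c : Cr n => (c.1 : ℕ)) (Option.some.inj hx)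
    simp only [middle] at this
    omega
  have heq : s (middle n d hdn ho) = s (middle n o hon hoo) := by
    rw [h.2 (middle n o hon hoo) (middle n d hdn ho) (Or.inr ⟨Or.inl
      ⟨hod, hoq, hoo, hq, ho, hbetween⟩, two_mul_middle_add_one n o hon hoo,
      two_mul_middle_add_one n d hdn ho⟩), if_pos (Or.inr rfl), one_mul]
  have hlt : d < (signWord n s).length := by rwa [length_signWord]
  have hw := (h.reduction_before hdn.le (by rintro c ⟨rfl⟩; exact le_rfl)).2.2 o hod hoq hoo
    hbetween
  rw [List.drop_eq_getElem_cons hlt, ← List.getD_eq_getElem _ 0 hlt, hvald, hvalo, heq] at hw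
  have hs := h.1 (middle n o hon hoo)
  have hw' := hw.trans (TEq.unit_cons_cons hs _ _)
  rw [← two_mul] at hw'
  exact reduces_to_two_of_equiv hlast hs hw'

end ResolvesPairs

/-- The last syllable `d` of the last NSI run, if that run has a crossing, is the second odd
syllable of the run or a nonempty even syllable forming the whole run, and at most one syllable
follows it. -/
theorem exists_last_nsi_syllable {n : List ℕ} (hend : phase n n.length ≠ .cross) {l r : ℕ}
    (hlr : IsLastNSIRun (natWord n) l r) (hpos : 0 < ∑ j ∈ Finset.Ico l r, n.getD j 0) :
    ∃ d, d < n.length ∧ n.length ≤ d + 2 ∧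
      (phase n d = .entry ∧ Even (n.getD d 0) ∧ 0 < n.getD d 0 ∨
        phase n d = .cross ∧ Odd (n.getD d 0)) := by
  obtain ⟨⟨h1, h2, h3, -, h5⟩, h6⟩ := hlr
  have hlen : (natWord n).length = n.length := by simp [natWord_eq_map]
  rw [hlen] at h2 h5 h6
  obtain ⟨d, rfl⟩ : ∃ d, r = d + 1 := ⟨r - 1, by omega⟩
  have hnsi : ∀ j, l ≤ j → j ≤ d → phase n j ≠ .si := fun j hj hj' h =>
    h3 j hj (by omega) ((isSISyl_natWord_iff n j (by omega)).2 h)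
  have hd := hnsi d (by omega) le_rfl
  have hr : phase n (d + 1) ≠ .cross := by
    rcases h5 with h | h
    · rwa [h]
    · simp [(isSISyl_natWord_iff n _ h2).1 h]
  refine ⟨d, h2, ?_, ?_⟩
  · by_contra! hlt
    have ha := (isSISyl_natWord_iff n _ h2).1 (h6 (d + 1) le_rfl (by omega))
    have hb := (isSISyl_natWord_iff n (d + 2) hlt.le).1 (h6 (d + 2) (by omega) hlt)
    rw [phase, ha] at hb
    simp [Phase.next] at hb
  · rw [phase] at hr
    cases hq : phase n d with
    | si => exact absurd hq hd
    | entry =>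
      have he : Even (n.getD d 0) := by
        by_contra hne
        simp only [hq, Phase.next, hne] at hr
        simp at hr
      have hld : l = d := by
        by_contra hne
        obtain ⟨m, rfl⟩ : ∃ m, d = m + 1 := ⟨d - 1, by omega⟩
        have hm := hnsi m (by omega) (by omega)
        rw [phase] at hq
        revert hq hm
        generalize phase n m = q
        by_cases he : Even (n.getD m 0) <;> cases q <;> simp only [Phase.next, he] <;> simp
      subst hld
      rw [Nat.Ico_succ_singleton, Finset.sum_singleton] at hpos
      exact Or.inl ⟨rfl, he, hpos⟩
    | cross =>
      refine Or.inr ⟨rfl, ?_⟩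
      by_contra hne
      rw [Nat.not_odd_iff_even] at hne
      simp only [hq, Phase.next, hne] at hr
      simp at hr


/-- if the syllable sizes `(n_1, …, n_k)` (a nonempty word) have an odd
total number of SI crossings and an even total number of NSI crossings, then in the
resolution game (i) the first player can force the resulting word to reduce to `(0)`,
and (ii) if moreover the last maximal run of NSI syllables contains at least one
crossing, the first player can force the resulting word `w` to satisfy `w ≈ (2)`,
`w ≈ (-2)`, or `w ≈ (2, c)` or `w ≈ (-2, c)` for some integer `c`. -/
theorem first_forces_reductions (n : List ℕ) (hne : n ≠ [])
    (hsi : Odd (siCrossings (natWord n))) (hnsi : Even (nsiCrossings (natWord n))) :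
    CanForce (C := Cr n) 0 (fun p => TEq (result n p) [0]) ∧
    ((∃ l r : ℕ, IsLastNSIRun (natWord n) l r ∧
        0 < ∑ j ∈ Finset.Ico l r, n.getD j 0) →
      CanForce (C := Cr n) 0 (fun p =>
        TEq (result n p) [2] ∨ TEq (result n p) [-2] ∨
        ∃ c : ℤ, TEq (result n p) [2, c] ∨ TEq (result n p) [-2, c])) := by
  have hend : phase n n.length ≠ .cross := fun h => by
    rw [nsiCrossings_natWord] at hnsi
    exact Nat.not_odd_iff_even.2 hnsi ((odd_sum_nsi_iff n _).2 h)
  refine ⟨canForce_of_resolvesPairs hsi hend none (TEq · [0]) fun s hs =>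
    hs.reduces_to_zero hne hend, ?_⟩
  rintro ⟨l, r, hlr, hpos⟩
  obtain ⟨d, hdn, hlast, ⟨hq, he, hd⟩ | ⟨hq, ho⟩⟩ := exists_last_nsi_syllable hend hlr hpos
  · have hd' : 0 < n.get ⟨d, hdn⟩ := getD_fin n ⟨d, hdn⟩ ▸ hd
    exact canForce_of_resolvesPairs hsi hend (some ⟨⟨d, hdn⟩, ⟨0, hd'⟩⟩)
      (fun w => TEq w [2] ∨ TEq w [-2] ∨ ∃ c : ℤ, TEq w [2, c] ∨ TEq w [-2, c])
      fun s hs => ResolvesPairs.reduces_to_two_of_entry hdn hlast hq he hd' hs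
  · exact canForce_of_resolvesPairs hsi hend (some (middle n d hdn ho))
      (fun w => TEq w [2] ∨ TEq w [-2] ∨ ∃ c : ℤ, TEq w [2, c] ∨ TEq w [-2, c])
      fun s hs => ResolvesPairs.reduces_to_two_of_cross hdn hlast hq ho hs
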